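/- For every integer n ≥ 8 and every integer k with 2 ≤ k ≤ n²/2, we have p_k(n,n) − p_{k−1}(n,n) ≥ C · 2^{√(2k)} / (2k)^{9/4}, where C = √(27/8)/π^{3/2}. -/

import Mathlib

/-- `p k l m`: the number of partitions of `k` fitting in an `l × m` rectangle,
i.e. with at most `l` parts, each part of size at most `m`. Equivalently, the
coefficient of `q^k` in the Gaussian binomial coefficient `C(l+m, m)_q`. -/
def p (k l m : ℕ) : ℕ :=
  Fintype.card {π : Nat.Partition k // π.parts.card ≤ l ∧ ∀ x ∈ π.parts, x ≤ m}

open Polynomial in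
/-- Gaussian binomial polynomial, by Pascal recursion. -/
noncomputable def GP : ℕ → ℕ → ℕ[X]
  | 0, _ => 1
  | _ + 1, 0 => 1
  | l + 1, m + 1 => GP (l + 1) m + X ^ (m + 1) * GP l (m + 1)
  termination_by l m => l + m

open Polynomial in
lemma GP_zero_left (m : ℕ) : GP 0 m = 1 := by rw [GP]

open Polynomial in
lemma GP_zero_right (l : ℕ) : GP l 0 = 1 := by cases l <;> rw [GP]

open Polynomial in
lemma GP_succ (l m : ℕ) : GP (l + 1) (m + 1) = GP (l + 1) m + X ^ (m + 1) * GP l (m + 1) := by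
  rw [GP]

open Polynomial in
lemma GP_succ' (s : ℕ) : ∀ l m : ℕ, l + m = s →
    GP (l + 1) (m + 1) = GP l (m + 1) + X ^ (l + 1) * GP (l + 1) m := by
  induction s using Nat.strong_induction_on with
  | _ s ih =>
    intro l m hs
    rw [GP_succ]
    rcases l with _ | l
    · rcases m with _ | m
      · simp [GP_zero_left, GP_zero_right]
      · have h2 := ih (0 + m) (by omega) 0 m rfl
        have h1 := GP_succ 0 m
        rw [GP_zero_left] at *
        have : (X : ℕ[X]) ^ (m + 1 + 1) = X ^ (0 + 1) * X ^ (m + 1) := by ring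
        rw [h2, mul_one, this] 
        nth_rewrite 2 [← h2]
        rw [h1]
        ring
    · rcases m with _ | m
      · have h2 := ih (l + 0) (by omega) l 0 rfl
        have h1 := GP_succ l 0
        rw [GP_zero_right] at *
        nth_rewrite 1 [h2]
        rw [h1]
        ring
      · have h1 := ih (l + 1 + m) (by omega) (l + 1) m rfl
        have h2 := ih (l + (m + 1)) (by omega) l (m + 1) rfl
        have h3 := GP_succ l (m + 1)
        have h4 := GP_succ (l + 1) m
        calc _ = (GP (l + 1) (m + 1) + X ^ (l + 1 + 1) * GP (l + 1 + 1) m) + X ^ (m + 1 + 1) *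
              (GP l (m + 1 + 1) + X ^ (l + 1) * GP (l + 1) (m + 1)) := by rw [h1, h2]
          _ = (GP (l + 1) (m + 1) + X ^ (m + 1 + 1) * GP l (m + 1 + 1)) + X ^ (l + 1 + 1) *
              (GP (l + 1 + 1) m + X ^ (m + 1) * GP (l + 1) (m + 1)) := by ring
          _ = _ := by rw [h3, h4]

open Polynomial in
lemma GP_symm (s : ℕ) : ∀ l m : ℕ, l + m = s → GP l m = GP m l := by
  induction s using Nat.strong_induction_on with
  | _ s ih =>
    intro l m hs
    rcases l with _ | l
    · rw [GP_zero_left, GP_zero_right]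
    rcases m with _ | m
    · rw [GP_zero_left, GP_zero_right]
    rw [GP_succ, GP_succ' _ m l rfl, ih _ _ (l + 1) m rfl, ih _ _ l (m + 1) rfl] <;> omega

open Polynomial in
lemma GP_mul (q : ℤ) (l m : ℕ) :
    (q ^ (l + 1) - 1) * ((GP (l + 1) m).eval₂ (Nat.castRingHom ℤ) q) =
    (q ^ (l + 1 + m) - 1) * ((GP l m).eval₂ (Nat.castRingHom ℤ) q) := by
  rcases m with _ | m
  · simp [GP_zero_right]
  · have h1 := congrArg (fun f => f.eval₂ (Nat.castRingHom ℤ) q) (GP_succ l m)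
    have h2 := congrArg (fun f => f.eval₂ (Nat.castRingHom ℤ) q) (GP_succ' _ l m rfl)
    simp only [eval₂_add, eval₂_mul, eval₂_pow, eval₂_X] at h1 h2
    have e : q ^ (l + 1 + (m + 1)) = q ^ (l + 1) * q ^ (m + 1) := by ring
    rw [e]
    linear_combination (-1 + 0) * h2 + q ^ (l + 1) * h1

/-- the computed value of the central Gaussian binomial at `Q`. -/
def EV (Q : ℕ) : ℕ → ℕ
  | 0 => 1
  | n + 1 => EV Q n * ((Q ^ (2 * n + 1) - 1) * (Q ^ (2 * n + 2) - 1)) / ((Q ^ (n + 1) - 1) * (Q ^ (n + 1) - 1))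

open Polynomial in
lemma eval_cast (f : ℕ[X]) (Q : ℕ) : ((f.eval Q : ℕ) : ℤ) = f.eval₂ (Nat.castRingHom ℤ) (Q : ℤ) := by
  rw [Polynomial.eval, ← Nat.coe_castRingHom, Polynomial.hom_eval₂]
  simp

open Polynomial in
lemma EV_eq (Q : ℕ) (hQ : 2 ≤ Q) (n : ℕ) : EV Q n = (GP n n).eval Q := by
  induction n with
  | zero => simp [EV, GP_zero_left]
  | succ n ih =>
    rw [EV, ih]
    have hp : ∀ j, 1 ≤ Q ^ j := fun j => Nat.one_le_pow _ _ (by omega)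
    have h1 := GP_mul (Q : ℤ) n n
    have h2 := GP_mul (Q : ℤ) n (n + 1)
    rw [GP_symm _ n (n + 1) rfl] at h2
    rw [← eval_cast, ← eval_cast] at h1 h2
    apply Nat.div_eq_of_eq_mul_left
    · have : Q ^ 1 ≤ Q ^ (n + 1) := Nat.pow_le_pow_right (by omega) (by omega)
      rw [pow_one] at this
      have : 0 < Q ^ (n + 1) - 1 := by omega
      positivity
    · zify [hp]
      have e1 : 2 * n + 1 = n + 1 + n := by ring
      have e2 : 2 * n + 2 = n + 1 + (n + 1) := by ring
      rw [e1, e2]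
      linear_combination (-(Q : ℤ) ^ (n + 1 + (n + 1)) + 1) * h1 - ((Q : ℤ) ^ (n + 1) - 1) * h2

open Polynomial in
lemma coeff_eval (Q : ℕ) (k : ℕ) : ∀ (f : ℕ[X]) (_ : ∀ i, f.coeff i < Q),
    f.eval Q / Q ^ k % Q = f.coeff k := by
  induction k with
  | zero =>
    intro f hf
    have h := divX_mul_X_add f
    have h' := congrArg (eval Q) h
    simp at h'
    rw [← h', pow_zero, Nat.div_one, Nat.mul_comm, Nat.mul_add_mod, Nat.mod_eq_of_lt (hf 0)]
  | succ k ih =>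
    intro f hf
    have h := divX_mul_X_add f
    have h' := congrArg (eval Q) h
    simp at h'
    have h0 := hf 0
    rw [pow_succ', ← Nat.div_div_eq_div_mul, ← h', Nat.mul_comm, Nat.mul_add_div (by omega), Nat.div_eq_of_lt h0,
      add_zero, ih, coeff_divX]
    intro i
    rw [coeff_divX]
    exact hf _

open Polynomial in
lemma GP_eval_one (s : ℕ) : ∀ l m : ℕ, l + m = s → (GP l m).eval 1 ≤ 2 ^ s := by
  induction s using Nat.strong_induction_on with
  | _ s ih =>
    intro l m hs
    rcases l with _ | l
    · rw [GP_zero_left]; simpa using Nat.one_le_two_pow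
    rcases m with _ | m
    · rw [GP_zero_right]; simpa using Nat.one_le_two_pow
    rw [GP_succ]
    have h1 := ih _ (by omega) (l + 1) m rfl
    have h2 := ih _ (by omega) l (m + 1) rfl
    simp
    obtain rfl : s = (l + 1 + m) + 1 := by omega
    rw [show l + (m + 1) = l + 1 + m by ring] at h2
    rw [pow_succ]; omega

open Polynomial in
lemma GP_coeff_le (l m k : ℕ) : (GP l m).coeff k ≤ 2 ^ (l + m) := by
  refine le_trans ?_ (GP_eval_one _ l m rfl)
  rw [eval_eq_sum, Polynomial.sum]
  simp only [one_pow, mul_one]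
  by_cases h : k ∈ (GP l m).support
  · exact Finset.single_le_sum (f := fun i => (GP l m).coeff i) (fun _ _ => Nat.zero_le _) h
  · rw [notMem_support_iff.mp h]; exact Nat.zero_le _

/-- the multisets counted by `p`. -/
def PS (k l m : ℕ) : Set (Multiset ℕ) :=
  {s | s.sum = k ∧ s.card ≤ l ∧ ∀ x ∈ s, 0 < x ∧ x ≤ m}

/-- partitions in a box as multisets. -/
def PSequiv (k l m : ℕ) : {π : Nat.Partition k // π.parts.card ≤ l ∧ ∀ x ∈ π.parts, x ≤ m} ≃ PS k l m where
  toFun π := ⟨π.1.parts, π.1.parts_sum, π.2.1, fun x hx => ⟨π.1.parts_pos hx, π.2.2 x hx⟩⟩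
  invFun s := ⟨⟨s.1, fun {i} hi => (s.2.2.2 i hi).1, s.2.1⟩, s.2.2.1, fun x hx => (s.2.2.2 x hx).2⟩
  left_inv π := by rfl
  right_inv s := by rfl

lemma PS_finite (k l m : ℕ) : (PS k l m).Finite := by
  have : Finite (PS k l m) := Finite.of_equiv _ (PSequiv k l m)
  exact Set.toFinite _

lemma p_eq_ncard (k l m : ℕ) : p k l m = (PS k l m).ncard := by
  rw [p, ← Nat.card_eq_fintype_card, Nat.card_congr (PSequiv k l m), Nat.card_coe_set_eq]

lemma PS_base (k l m : ℕ) (h : l = 0 ∨ m = 0) : PS k l m = if k = 0 then {0} else ∅ := by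
  have key : ∀ s ∈ PS k l m, s = 0 := by
    rintro s ⟨h1, h2, h3⟩
    rcases h with rfl | rfl
    · simpa using h2
    · refine Multiset.eq_zero_of_forall_notMem fun x hx => ?_
      have := h3 x hx
      omega
  split_ifs with hk
  · subst hk
    ext s
    constructor
    · intro hs; exact key s hs
    · rintro rfl; simp [PS]
  · ext s
    simp only [Set.mem_empty_iff_false, iff_false]
    intro hs
    have := key s hs
    subst this
    exact hk (by simpa using hs.1.symm)

lemma PS_step (k l m : ℕ) : (PS k (l + 1) (m + 1)).ncard =
    (PS k (l + 1) m).ncard + if m + 1 ≤ k then (PS (k - (m + 1)) l (m + 1)).ncard else 0 := by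
  have hu : PS k (l + 1) (m + 1) = PS k (l + 1) m ∪
      (if m + 1 ≤ k then (fun s => (m + 1) ::ₘ s) '' PS (k - (m + 1)) l (m + 1) else ∅) := by
    ext s
    constructor
    · rintro ⟨h1, h2, h3⟩
      by_cases hm : m + 1 ∈ s
      · right
        obtain ⟨t, rfl⟩ := Multiset.exists_cons_of_mem hm
        rw [Multiset.sum_cons] at h1
        rw [Multiset.card_cons] at h2
        rw [if_pos (by omega)]
        exact ⟨t, ⟨by omega, by omega, fun x hx => h3 x (Multiset.mem_cons_of_mem hx)⟩, rfl⟩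
      · left
        refine ⟨h1, h2, fun x hx => ⟨(h3 x hx).1, ?_⟩⟩
        have := h3 x hx
        have : x ≠ m + 1 := fun h => hm (h ▸ hx)
        omega
    · rintro (⟨h1, h2, h3⟩ | h)
      · exact ⟨h1, h2, fun x hx => ⟨(h3 x hx).1, (h3 x hx).2.trans (by omega)⟩⟩
      · split_ifs at h with hk
        · obtain ⟨t, ⟨h1, h2, h3⟩, rfl⟩ := h
          refine ⟨by simp [h1]; omega, by simp; omega, ?_⟩
          intro x hx
          rcases Multiset.mem_cons.mp hx with rfl | hx
          · omega
          · exact h3 x hx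
        · exact h.elim
  have hf : (if m + 1 ≤ k then (fun s => (m + 1) ::ₘ s) '' PS (k - (m + 1)) l (m + 1) else ∅).Finite := by
    split_ifs
    · exact (PS_finite _ _ _).image _
    · exact Set.finite_empty
  rw [hu, Set.ncard_union_eq ?_ (PS_finite _ _ _) hf]
  · congr 1
    split_ifs
    · exact Set.ncard_image_of_injective _ (fun a b h => by simpa using h)
    · simp
  · rw [Set.disjoint_left]
    rintro s ⟨h1, h2, h3⟩ h
    split_ifs at h with hk
    · obtain ⟨t, _, rfl⟩ := h
      have := h3 (m + 1) (Multiset.mem_cons_self _ _)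
      omega
    · exact h

lemma p_eq_coeff (s : ℕ) : ∀ l m k : ℕ, l + m = s → p k l m = (GP l m).coeff k := by
  induction s using Nat.strong_induction_on with
  | _ s ih =>
    intro l m k hs
    by_cases h0 : l = 0 ∨ m = 0
    · rw [p_eq_ncard, PS_base k l m h0]
      have : GP l m = 1 := by
        rcases h0 with rfl | rfl
        · exact GP_zero_left m
        · exact GP_zero_right l
      rw [this, Polynomial.coeff_one]
      split_ifs with h <;> simp_all
    · push Not at h0
      obtain ⟨l, rfl⟩ := Nat.exists_eq_succ_of_ne_zero h0.1
      obtain ⟨m, rfl⟩ := Nat.exists_eq_succ_of_ne_zero h0.2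
      rw [p_eq_ncard, Nat.succ_eq_add_one, Nat.succ_eq_add_one, PS_step, GP_succ, Polynomial.coeff_add, Polynomial.coeff_X_pow_mul',
        ← p_eq_ncard, ← p_eq_ncard, ih _ (by omega) (l + 1) m k rfl, ih _ (by omega) l (m + 1) _ rfl]

/-! ### subsets -/

/-- subsets of `range N` of size `l` and sum `s`. -/
def SB (N l s : ℕ) : Finset (Finset ℕ) :=
  ((Finset.range N).powersetCard l).filter (fun A => ∑ i ∈ A, i = s)

lemma GP_subsets (s : ℕ) : ∀ l m : ℕ, l + m = s →
    ∑ A ∈ (Finset.range (l + m)).powersetCard l, (Polynomial.X : Polynomial ℕ) ^ (∑ i ∈ A, i) =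
      Polynomial.X ^ (∑ i ∈ Finset.range l, i) * GP l m := by
  induction s using Nat.strong_induction_on with
  | _ s ih =>
    intro l m hs
    rcases l with _ | l
    · simp [GP_zero_left]
    rcases m with _ | m
    · rw [GP_zero_right, add_zero]
      have := Finset.powersetCard_self (Finset.range (l + 1))
      rw [Finset.card_range] at this
      rw [this]; simp
    · rw [show l + 1 + (m + 1) = (l + 1 + m) + 1 by ring, Finset.range_add_one,
        Finset.powersetCard_succ_insert (by simp), Finset.sum_union, Finset.sum_image]
      · rw [ih _ (by omega) (l + 1) m rfl]
        have h2 := ih _ (by omega) l (m + 1) rfl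
        have : ∀ A ∈ (Finset.range (l + 1 + m)).powersetCard l,
            (Polynomial.X : Polynomial ℕ) ^ (∑ i ∈ insert (l + 1 + m) A, i) =
              Polynomial.X ^ (l + 1 + m) * Polynomial.X ^ (∑ i ∈ A, i) := by
          intro A hA
          rw [Finset.sum_insert, pow_add]
          intro h
          have := (Finset.mem_powersetCard.mp hA).1 h
          simp at this
        rw [Finset.sum_congr rfl this, ← Finset.mul_sum]
        rw [show l + 1 + m = l + (m + 1) by ring, h2, GP_succ, Finset.sum_range_succ]
        ring
      · intro A hA B hB hAB
        have hA' : l + 1 + m ∉ A := fun h => by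
          have := (Finset.mem_powersetCard.mp hA).1 h
          simp at this
        have hB' : l + 1 + m ∉ B := fun h => by
          have := (Finset.mem_powersetCard.mp hB).1 h
          simp at this
        rw [← Finset.erase_insert hA', ← Finset.erase_insert hB']
        change insert _ A = insert _ B at hAB
        rw [hAB]
      · rw [Finset.disjoint_left]
        intro A hA hA2
        obtain ⟨B, hB, rfl⟩ := Finset.mem_image.mp hA2
        have := (Finset.mem_powersetCard.mp hA).1 (Finset.mem_insert_self _ _)
        simp at this

lemma SB_card (l m k : ℕ) : (SB (l + m) l (k + ∑ i ∈ Finset.range l, i)).card = (GP l m).coeff k := by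
  have h := congrArg (fun f => Polynomial.coeff f (k + ∑ i ∈ Finset.range l, i)) (GP_subsets _ l m rfl)
  simp only [Polynomial.coeff_X_pow_mul, Polynomial.finsetSum_coeff, Polynomial.coeff_X_pow] at h
  rw [← h, SB, Finset.card_filter]
  refine Finset.sum_congr rfl fun A _ => ?_
  simp only [eq_comm]

/-! ### unimodality -/

/-- toggling `i` and `i+1`. -/
def TT (i : ℕ) (A : Finset ℕ) : Finset ℕ := symmDiff A {i, i + 1}

lemma TT_TT (i : ℕ) (A : Finset ℕ) : TT i (TT i A) = A := by
  simp [TT]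

lemma TT_comm (i j : ℕ) (A : Finset ℕ) : TT i (TT j A) = TT j (TT i A) := by
  simp only [TT, symmDiff_assoc]
  rw [symmDiff_comm {j, j + 1}]

lemma mem_TT (i x : ℕ) (A : Finset ℕ) : x ∈ TT i A ↔ (x ∈ A ↔ ¬ (x = i ∨ x = i + 1)) := by
  simp only [TT, Finset.mem_symmDiff, Finset.mem_insert, Finset.mem_singleton]
  tauto

/-- can move down -/
def dn (i : ℕ) (A : Finset ℕ) : Prop := i ∉ A ∧ i + 1 ∈ A

/-- can move up -/
def up (i : ℕ) (A : Finset ℕ) : Prop := i ∈ A ∧ i + 1 ∉ A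

lemma dn_TT (i : ℕ) (A : Finset ℕ) : dn i (TT i A) ↔ up i A := by
  simp only [dn, up, mem_TT]; grind

lemma dn_dn_TT (i j : ℕ) (hij : i ≠ j) (A : Finset ℕ) :
    (dn i (TT i (TT j A)) ∧ dn j (TT i (TT j A))) ↔ (up i A ∧ up j A) := by
  simp only [dn, up, mem_TT]
  have : ¬ (i + 1 = i) := by omega
  have : ¬ (j + 1 = j) := by omega
  have : ¬ (i = i + 1) := by omega
  have : ¬ (j = j + 1) := by omega
  have : ¬ (j = i) := by omega
  have : ¬ (i + 1 = j + 1) := by omega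
  have : ¬ (j + 1 = i + 1) := by omega
  by_cases h1 : i = j + 1
  · subst h1
    have : ¬ (j + 1 + 1 = j) := by omega
    have : ¬ (j = j + 1 + 1) := by omega
    simp only [*]
    tauto
  · by_cases h2 : j = i + 1
    · subst h2
      have : ¬ (i + 1 + 1 = i) := by omega
      have : ¬ (i = i + 1 + 1) := by omega
      simp only [*]
      tauto
    · have : ¬ (i + 1 = j) := by omega
      have : ¬ (j + 1 = i) := by omega
      simp only [*]
      tauto

lemma TT_subset (N i : ℕ) (hi : i + 1 < N) (A : Finset ℕ) (hA : A ⊆ Finset.range N) :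
    TT i A ⊆ Finset.range N := by
  intro x hx
  rw [mem_TT] at hx
  by_cases h : x ∈ A
  · exact hA h
  · rw [Finset.mem_range]
    have : x = i ∨ x = i + 1 := by tauto
    omega

lemma TT_dn_card (i : ℕ) (A : Finset ℕ) (h : dn i A) :
    (TT i A).card = A.card ∧ (∑ x ∈ TT i A, x) + 1 = ∑ x ∈ A, x := by
  have e1 : TT i A = insert i (A.erase (i + 1)) := by
    ext x
    rw [mem_TT, Finset.mem_insert, Finset.mem_erase]
    obtain ⟨h1, h2⟩ := h
    by_cases hx : x = i
    · subst hx; simp [h1]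
    · by_cases hx' : x = i + 1
      · subst hx'; simp [h2]
      · simp [hx, hx']
  have hn : i ∉ A.erase (i + 1) := fun hh => h.1 (Finset.mem_of_mem_erase hh)
  rw [e1, Finset.card_insert_of_notMem hn, Finset.sum_insert hn, Finset.card_erase_of_mem h.2]
  have h5 : (i + 1) + ∑ x ∈ A.erase (i + 1), x = ∑ x ∈ A, x := Finset.add_sum_erase A (fun x => x) h.2
  have := Finset.card_pos.mpr ⟨_, h.2⟩
  omega

/-- weight -/
noncomputable def cw (N i : ℕ) : ℝ := Real.sqrt ((i + 1 : ℝ) * (N - 1 - i))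

open Classical in
/-- raising operator -/
noncomputable def UU (N : ℕ) (x : Finset ℕ → ℝ) (B : Finset ℕ) : ℝ :=
  ∑ i ∈ Finset.range (N - 1), if dn i B then cw N i * x (TT i B) else 0

open Classical in
/-- lowering operator -/
noncomputable def DD (N : ℕ) (x : Finset ℕ → ℝ) (B : Finset ℕ) : ℝ :=
  ∑ i ∈ Finset.range (N - 1), if up i B then cw N i * x (TT i B) else 0

lemma sum_TT (N i : ℕ) (hi : i + 1 < N) (f : Finset ℕ → ℝ) :
    ∑ A ∈ (Finset.range N).powerset, f A = ∑ A ∈ (Finset.range N).powerset, f (TT i A) := by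
  refine Finset.sum_nbij' (TT i) (TT i) ?_ ?_ ?_ ?_ ?_
  · intro A hA; rw [Finset.mem_powerset] at *; exact TT_subset N i hi A hA
  · intro A hA; rw [Finset.mem_powerset] at *; exact TT_subset N i hi A hA
  · intro A _; exact TT_TT i A
  · intro A _; exact TT_TT i A
  · intro A _; rw [TT_TT]

open Classical in
lemma diag_id (N : ℕ) (A : Finset ℕ) (hA : A ⊆ Finset.range N) :
    (∑ i ∈ Finset.range (N - 1), if up i A then (cw N i) ^ 2 else 0) -
    (∑ i ∈ Finset.range (N - 1), if dn i A then (cw N i) ^ 2 else 0) =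
      ∑ i ∈ A, ((N : ℝ) - 1 - 2 * i) := by
  have hw : ∀ i ∈ Finset.range (N - 1), cw N i ^ 2 = (i + 1 : ℝ) * (N - 1 - i) := by
    intro i hi
    rw [cw, Real.sq_sqrt]
    have : i + 1 < N := by have := Finset.mem_range.mp hi; omega
    have : ((i + 1 : ℕ) : ℝ) < N := by exact_mod_cast this
    push_cast at this
    apply mul_nonneg <;> [positivity; linarith]
  rw [← Finset.sum_sub_distrib]
  -- telescoping
  have key : ∀ K, K + 1 ≤ N → ∑ i ∈ Finset.range K, ((if up i A then (cw N i) ^ 2 else 0) -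
      (if dn i A then (cw N i) ^ 2 else 0)) =
      ∑ i ∈ (Finset.range (K + 1)).filter (· ∈ A), ((N : ℝ) - 1 - 2 * i) -
        (if K ∈ A then (K + 1 : ℝ) * (N - 1 - K) else 0) := by
    intro K
    induction K with
    | zero =>
      intro _
      rw [Finset.sum_filter, zero_add, Finset.sum_range_one, Finset.sum_range_zero]
      split_ifs <;> simp
    | succ K ih =>
      intro hK
      rw [Finset.sum_range_succ, ih (by omega), hw K (Finset.mem_range.mpr (by omega))]
      rw [Finset.sum_filter, Finset.sum_filter, Finset.sum_range_succ _ (K + 1)]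
      by_cases h1 : K ∈ A <;> by_cases h2 : K + 1 ∈ A <;> simp [up, dn, h1, h2] <;> ring
  rcases N with _ | N
  · have : A = ∅ := by simpa using hA
    subst this; simp
  · rw [show N + 1 - 1 = N by omega, key N (by omega)]
    have : (Finset.range (N + 1)).filter (· ∈ A) = A := by
      ext x; simp only [Finset.mem_filter]
      exact ⟨fun h => h.2, fun h => ⟨hA h, h⟩⟩
    rw [this]
    push_cast
    split_ifs <;> ring

open Classical in
lemma norm_id (N : ℕ) (x : Finset ℕ → ℝ) :
    ∑ B ∈ (Finset.range N).powerset, (UU N x B) ^ 2 =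
    ∑ B ∈ (Finset.range N).powerset, (DD N x B) ^ 2 +
    ∑ A ∈ (Finset.range N).powerset, (x A) ^ 2 * ∑ i ∈ A, ((N : ℝ) - 1 - 2 * i) := by
  have e : ∀ A ∈ (Finset.range N).powerset, (x A) ^ 2 * ∑ i ∈ A, ((N : ℝ) - 1 - 2 * i) =
      (∑ i ∈ Finset.range (N - 1), if up i A then (cw N i) ^ 2 * x A ^ 2 else 0) -
    (∑ i ∈ Finset.range (N - 1), if dn i A then (cw N i) ^ 2 * x A ^ 2 else 0) := by
    intro A hA
    rw [← diag_id N A (Finset.mem_powerset.mp hA), mul_sub, Finset.mul_sum, Finset.mul_sum]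
    simp only [mul_ite, mul_zero, mul_comm]
  rw [Finset.sum_congr rfl e, Finset.sum_sub_distrib]
  simp only [UU, DD, sq (Finset.sum _ _), Finset.sum_mul_sum]
  rw [Finset.sum_comm (s := (Finset.range N).powerset) (t := Finset.range (N - 1)),
    Finset.sum_comm (s := (Finset.range N).powerset) (t := Finset.range (N - 1)),
    Finset.sum_comm (s := (Finset.range N).powerset) (t := Finset.range (N - 1)),
    Finset.sum_comm (s := (Finset.range N).powerset) (t := Finset.range (N - 1)),
    ← Finset.sum_sub_distrib, ← Finset.sum_add_distrib]
  refine Finset.sum_congr rfl fun i hi => ?_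
  have hi' : i + 1 < N := by have := Finset.mem_range.mp hi; omega
  rw [Finset.sum_comm, Finset.sum_comm (s := (Finset.range N).powerset) (t := Finset.range (N - 1)),
    ← Finset.add_sum_erase _ _ hi, ← Finset.add_sum_erase _ _ hi]
  have off : ∀ j ∈ (Finset.range (N - 1)).erase i,
      (∑ B ∈ (Finset.range N).powerset, (if dn i B then cw N i * x (TT i B) else 0) *
        (if dn j B then cw N j * x (TT j B) else 0)) =
      ∑ B ∈ (Finset.range N).powerset, (if up i B then cw N i * x (TT i B) else 0) *
        (if up j B then cw N j * x (TT j B) else 0) := by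
    intro j hj
    have hij : i ≠ j := (Finset.ne_of_mem_erase hj).symm
    have hj' : j + 1 < N := by have := Finset.mem_range.mp (Finset.mem_of_mem_erase hj); omega
    rw [sum_TT N i hi', sum_TT N j hj']
    refine Finset.sum_congr rfl fun A _ => ?_
    have h := dn_dn_TT i j hij A
    rw [TT_TT, TT_comm i j, TT_TT]
    rw [TT_comm i j] at h
    by_cases ha : up i A <;> by_cases hb : up j A <;> by_cases hc : dn i (TT j (TT i A)) <;>
      by_cases hd : dn j (TT j (TT i A)) <;> simp_all
    ring
  rw [Finset.sum_congr rfl off]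
  have d1 : ∑ B ∈ (Finset.range N).powerset, (if dn i B then cw N i * x (TT i B) else 0) *
        (if dn i B then cw N i * x (TT i B) else 0) =
      ∑ A ∈ (Finset.range N).powerset, if up i A then (cw N i) ^ 2 * x A ^ 2 else 0 := by
    rw [sum_TT N i hi']
    refine Finset.sum_congr rfl fun A _ => ?_
    simp only [dn_TT, TT_TT]
    split_ifs <;> ring
  have d2 : ∑ B ∈ (Finset.range N).powerset, (if up i B then cw N i * x (TT i B) else 0) *
        (if up i B then cw N i * x (TT i B) else 0) =
      ∑ A ∈ (Finset.range N).powerset, if dn i A then (cw N i) ^ 2 * x A ^ 2 else 0 := by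
    rw [sum_TT N i hi']
    refine Finset.sum_congr rfl fun A _ => ?_
    have : up i (TT i A) ↔ dn i A := by rw [← dn_TT, TT_TT]
    simp only [this, TT_TT]
    split_ifs <;> ring
  rw [d1, d2]
  ring

lemma SB_mono (N l s : ℕ) (h : 2 * s < l * (N - 1)) : (SB N l s).card ≤ (SB N l (s + 1)).card := by
  classical
  let ext0 : (SB N l s → ℝ) →ₗ[ℝ] (Finset ℕ → ℝ) :=
    { toFun := fun x A => if hA : A ∈ SB N l s then x ⟨A, hA⟩ else 0
      map_add' := by intro x y; ext A; by_cases hA : A ∈ SB N l s <;> simp [hA]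
      map_smul' := by intro c x; ext A; by_cases hA : A ∈ SB N l s <;> simp [hA] }
  let f : (SB N l s → ℝ) →ₗ[ℝ] (SB N l (s + 1) → ℝ) :=
    { toFun := fun x B => UU N (ext0 x) B.1
      map_add' := by
        intro x y; ext B
        simp only [UU, map_add, Pi.add_apply, ← Finset.sum_add_distrib]
        refine Finset.sum_congr rfl fun i _ => ?_
        split_ifs <;> ring
      map_smul' := by
        intro c x; ext B
        simp only [UU, map_smul, Pi.smul_apply, smul_eq_mul, RingHom.id_apply, Finset.mul_sum]
        refine Finset.sum_congr rfl fun i _ => ?_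
        split_ifs <;> ring }
  have hf : Function.Injective f := by
    rw [← LinearMap.ker_eq_bot, LinearMap.ker_eq_bot']
    intro x hx
    have hsupp : ∀ A, A ∉ SB N l s → ext0 x A = 0 := by
      intro A hA; simp [ext0, hA]
    have hU : ∀ B ∈ (Finset.range N).powerset, UU N (ext0 x) B = 0 := by
      intro B hB
      by_cases hBs : B ∈ SB N l (s + 1)
      · have := congrFun hx ⟨B, hBs⟩
        exact this
      · rw [UU]
        refine Finset.sum_eq_zero fun i hi => ?_
        split_ifs with hd
        · rw [hsupp, mul_zero]
          intro hT
          apply hBs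
          simp only [SB, Finset.mem_filter, Finset.mem_powersetCard] at hT ⊢
          have := TT_dn_card i B hd
          exact ⟨⟨Finset.mem_powerset.mp hB, by omega⟩, by omega⟩
        · rfl
    have hid := norm_id N (ext0 x)
    rw [Finset.sum_eq_zero (fun B hB => by rw [hU B hB]; norm_num)] at hid
    have hw : ∀ A ∈ (Finset.range N).powerset,
        (ext0 x A) ^ 2 * ∑ i ∈ A, ((N : ℝ) - 1 - 2 * i) = (ext0 x A) ^ 2 * (l * (N - 1) - 2 * s) := by
      intro A hA
      by_cases hAs : A ∈ SB N l s
      · simp only [SB, Finset.mem_filter, Finset.mem_powersetCard] at hAs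
        rw [Finset.sum_sub_distrib, ← Finset.mul_sum, ← Nat.cast_sum, hAs.2, Finset.sum_const, hAs.1.2]
        simp
      · rw [hsupp A hAs]; ring
    rw [Finset.sum_congr rfl hw] at hid
    have hpos : (0 : ℝ) < l * (N - 1) - 2 * s := by
      rcases N with _ | N
      · simp at h
      · simp only [Nat.add_sub_cancel] at h
        have : ((2 * s : ℕ) : ℝ) < ((l * N : ℕ) : ℝ) := by exact_mod_cast h
        push_cast at this ⊢
        linarith
    have h1 : 0 ≤ ∑ B ∈ (Finset.range N).powerset, (DD N (ext0 x) B) ^ 2 :=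
      Finset.sum_nonneg fun _ _ => sq_nonneg _
    have h2 : ∀ A ∈ (Finset.range N).powerset, 0 ≤ (ext0 x A) ^ 2 * (l * (N - 1) - 2 * s : ℝ) :=
      fun A _ => mul_nonneg (sq_nonneg _) hpos.le
    have h3 : ∑ A ∈ (Finset.range N).powerset, (ext0 x A) ^ 2 * (l * (N - 1) - 2 * s : ℝ) = 0 := by
      have := Finset.sum_nonneg h2
      linarith
    have h4 := (Finset.sum_eq_zero_iff_of_nonneg h2).mp h3
    ext ⟨A, hA⟩
    have h5 := h4 A (by
      simp only [SB, Finset.mem_filter, Finset.mem_powersetCard] at hA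
      exact Finset.mem_powerset.mpr hA.1.1)
    have h6 : ext0 x A = 0 := by
      rcases mul_eq_zero.mp h5 with h | h
      · exact pow_eq_zero_iff (two_ne_zero) |>.mp h
      · linarith
    simpa [ext0, hA] using h6
  have := LinearMap.finrank_le_finrank_of_injective hf
  simpa using this

lemma GP_unimodal (l m k : ℕ) (h : 2 * k < l * m) : (GP l m).coeff k ≤ (GP l m).coeff (k + 1) := by
  rw [← SB_card, ← SB_card, show k + 1 + ∑ i ∈ Finset.range l, i = (k + ∑ i ∈ Finset.range l, i) + 1 by ring]
  apply SB_mono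
  have := Finset.sum_range_id_mul_two l
  rcases l with _ | l
  · simp at h
  · simp only [Nat.add_sub_cancel] at this
    rw [show l + 1 + m - 1 = l + m by omega]
    nlinarith

/-- monotonicity of the differences along squares. -/
lemma delta_mono (n k : ℕ) (h : 2 * (k + 1) ≤ n ^ 2) :
    (GP n n).coeff (k + 1) + (GP (n + 1) (n + 1)).coeff k ≤
      (GP n n).coeff k + (GP (n + 1) (n + 1)).coeff (k + 1) := by
  rcases n with _ | n
  · simp at h
  have e : GP (n + 1 + 1) (n + 1 + 1) = GP (n + 1) (n + 1) + Polynomial.X ^ (n + 1 + 1) * GP n (n + 1 + 1) +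
      Polynomial.X ^ (n + 1 + 1) * GP (n + 1) (n + 1 + 1) := by
    rw [GP_succ (n + 1) (n + 1), GP_symm _ (n + 1 + 1) (n + 1) rfl, ← GP_succ]
  have gen : ∀ f : Polynomial ℕ, (∀ j, 2 * j ≤ n ^ 2 → f.coeff j ≤ f.coeff (j + 1)) →
      (Polynomial.X ^ (n + 1 + 1) * f).coeff k ≤ (Polynomial.X ^ (n + 1 + 1) * f).coeff (k + 1) := by
    intro f hf
    rw [Polynomial.coeff_X_pow_mul', Polynomial.coeff_X_pow_mul']
    split_ifs with h1 h2
    · rw [show k + 1 - (n + 1 + 1) = k - (n + 1 + 1) + 1 by omega]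
      apply hf
      have : 2 * k ≤ n ^ 2 + 2 * n := by nlinarith
      omega
    · omega
    · exact Nat.zero_le _
    · exact le_rfl
  have g1 := gen (GP n (n + 1 + 1)) (fun j hj => by
    rcases Nat.eq_zero_or_pos n with rfl | hn
    · obtain rfl : j = 0 := by simpa using hj
      omega
    · exact GP_unimodal _ _ _ (by nlinarith))
  have g2 := gen (GP (n + 1) (n + 1 + 1)) (fun j hj => GP_unimodal _ _ _ (by nlinarith))
  rw [e]
  simp only [Polynomial.coeff_add]
  omega

lemma delta_mono_le (n n' k : ℕ) (hn : n ≤ n') (h : 2 * (k + 1) ≤ n ^ 2) :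
    (GP n n).coeff (k + 1) + (GP n' n').coeff k ≤
      (GP n n).coeff k + (GP n' n').coeff (k + 1) := by
  induction n', hn using Nat.le_induction with
  | base => omega
  | succ m hm ih =>
    have := delta_mono m k (h.trans (Nat.pow_le_pow_left hm 2))
    omega

/-! ### Fourier analysis -/

lemma cos_mul_prod (s : Finset ℕ) (y : ℕ → ℝ) : ∀ c : ℝ,
    Real.cos c * ∏ i ∈ s, (2 * Real.cos (y i)) =
      ∑ A ∈ s.powerset, Real.cos (c + 2 * ∑ i ∈ A, y i - ∑ i ∈ s, y i) := by
  induction s using Finset.induction_on with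
  | empty => intro c; simp
  | insert a s ha ih =>
    intro c
    rw [Finset.prod_insert ha, Finset.sum_powerset_insert ha]
    have h1 := ih (c - y a)
    have h2 := ih (c + y a)
    have e1 : ∑ A ∈ s.powerset, Real.cos (c + 2 * ∑ i ∈ A, y i - ∑ i ∈ insert a s, y i) =
        ∑ A ∈ s.powerset, Real.cos (c - y a + 2 * ∑ i ∈ A, y i - ∑ i ∈ s, y i) := by
      refine Finset.sum_congr rfl fun A _ => ?_
      rw [Finset.sum_insert ha]; congr 1; ring
    have e2 : ∑ A ∈ s.powerset, Real.cos (c + 2 * ∑ i ∈ insert a A, y i - ∑ i ∈ insert a s, y i) =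
        ∑ A ∈ s.powerset, Real.cos (c + y a + 2 * ∑ i ∈ A, y i - ∑ i ∈ s, y i) := by
      refine Finset.sum_congr rfl fun A hA => ?_
      rw [Finset.sum_insert ha, Finset.sum_insert (fun h => ha (Finset.mem_powerset.mp hA h))]
      congr 1; ring
    rw [e1, e2, ← h1, ← h2, Real.cos_add, Real.cos_sub]
    ring

/-- the half-angle -/
noncomputable def yy (n : ℕ) (φ θ : ℝ) (i : ℕ) : ℝ := (φ + (2 * i - (2 * n - 1)) * θ) / 2

/-- the product kernel -/
noncomputable def FF (n : ℕ) (φ θ : ℝ) : ℝ := ∏ i ∈ Finset.range (2 * n), (2 * Real.cos (yy n φ θ i))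

lemma sum_yy (n : ℕ) (φ θ : ℝ) : ∑ i ∈ Finset.range (2 * n), yy n φ θ i = n * φ := by
  have h : ∀ K : ℕ, ∑ i ∈ Finset.range K, yy n φ θ i = (K * φ + K * (K - 2 * n) * θ) / 2 := by
    intro K
    induction K with
    | zero => simp
    | succ K ih => rw [Finset.sum_range_succ, ih, yy]; push_cast; ring
  rw [h]; push_cast; ring

lemma FF_expand (n : ℕ) (φ θ c : ℝ) : Real.cos (c * θ) * FF n φ θ =
    ∑ A ∈ (Finset.range (2 * n)).powerset,
      Real.cos (((A.card : ℤ) - (n : ℤ) : ℤ) * φ +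
        (c + 2 * (∑ i ∈ A, i : ℕ) - A.card * (2 * n - 1)) * θ) := by
  rw [FF, cos_mul_prod]
  refine Finset.sum_congr rfl fun A _ => ?_
  rw [sum_yy]
  congr 1
  simp only [yy]
  rw [← Finset.sum_div, Finset.sum_add_distrib, ← Finset.sum_mul, Finset.sum_sub_distrib, ← Finset.mul_sum,
    Finset.sum_const, Finset.sum_const]
  push_cast
  simp only [nsmul_eq_mul]
  ring

lemma int_cos (j : ℤ) (b : ℝ) : ∫ φ in (-Real.pi)..Real.pi, Real.cos (j * φ + b) =
    if j = 0 then 2 * Real.pi * Real.cos b else 0 := by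
  split_ifs with h
  · subst h; simp; left; ring
  · have hj : (j : ℝ) ≠ 0 := by exact_mod_cast h
    rw [intervalIntegral.integral_comp_mul_add (fun x => Real.cos x) hj, integral_cos]
    have : Real.sin (j * Real.pi + b) = Real.sin (j * -Real.pi + b) := by
      have := Real.sin_add_int_mul_two_pi (j * -Real.pi + b) j
      rw [← this]; congr 1; ring
    rw [this]; simp

lemma int_cos2 (j : ℤ) : ∫ θ in (0 : ℝ)..(Real.pi / 2), Real.cos ((2 * j : ℤ) * θ) =
    if j = 0 then Real.pi / 2 else 0 := by
  split_ifs with h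
  · subst h; simp
  · have hj : ((2 * j : ℤ) : ℝ) ≠ 0 := by exact_mod_cast (by omega : 2 * j ≠ 0)
    rw [intervalIntegral.integral_comp_mul_left (fun x => Real.cos x) hj, integral_cos]
    have : ((2 * j : ℤ) : ℝ) * (Real.pi / 2) = j * Real.pi := by push_cast; ring
    rw [this, Real.sin_int_mul_pi]; simp

/-- averaged kernel -/
noncomputable def XX (n : ℕ) (θ : ℝ) : ℝ := (∫ φ in (-Real.pi)..Real.pi, FF n φ θ) / (2 * Real.pi)

lemma XX_expand (n : ℕ) (θ c : ℝ) : Real.cos (c * θ) * XX n θ =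
    ∑ A ∈ (Finset.range (2 * n)).powersetCard n,
      Real.cos ((c + 2 * (∑ i ∈ A, i : ℕ) - n * (2 * n - 1)) * θ) := by
  have hpi := Real.pi_pos
  rw [XX, mul_div_assoc', ← intervalIntegral.integral_const_mul]
  simp only [FF_expand]
  rw [intervalIntegral.integral_finsetSum]
  · simp only [int_cos]
    rw [div_eq_iff (by positivity), Finset.sum_mul, Finset.powersetCard_eq_filter, Finset.sum_filter]
    refine Finset.sum_congr rfl fun A _ => ?_
    by_cases hA : A.card = n
    · rw [if_pos (by omega), if_pos hA, hA]; ring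
    · simp [sub_eq_zero, hA]
  · intro A _
    apply Continuous.intervalIntegrable
    fun_prop

lemma XX_cont (n : ℕ) : Continuous (XX n) := by
  have : XX n = fun θ => ∑ A ∈ (Finset.range (2 * n)).powersetCard n,
      Real.cos ((0 + 2 * (∑ i ∈ A, i : ℕ) - n * (2 * n - 1)) * θ) := by
    ext θ
    rw [← XX_expand]; simp
  rw [this]
  fun_prop

lemma int_XX (n k : ℕ) : ∫ θ in (0 : ℝ)..(Real.pi / 2),
    Real.cos (((n : ℝ) ^ 2 - 2 * k) * θ) * XX n θ =
      Real.pi / 2 * (SB (2 * n) n (k + ∑ i ∈ Finset.range n, i)).card := by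
  simp only [XX_expand]
  rw [intervalIntegral.integral_finsetSum]
  · have hT : 2 * ((∑ i ∈ Finset.range n, i : ℕ) : ℤ) = n ^ 2 - n := by
      have h := Finset.sum_range_id_mul_two n
      rcases n with _ | n
      · simp
      · simp only [Nat.add_sub_cancel] at h
        zify at h
        push_cast
        linarith
    rw [SB, Finset.card_filter, Nat.cast_sum, Finset.mul_sum]
    refine Finset.sum_congr rfl fun A _ => ?_
    have := int_cos2 ((∑ i ∈ A, i : ℕ) - (k + ∑ i ∈ Finset.range n, i : ℕ))
    have e : (((2 * ((∑ i ∈ A, i : ℕ) - (k + ∑ i ∈ Finset.range n, i : ℕ)) : ℤ)) : ℝ) =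
        (n : ℝ) ^ 2 - 2 * k + 2 * (∑ i ∈ A, i : ℕ) - n * (2 * n - 1) := by
      have : (2 * ((∑ i ∈ A, i : ℕ) - (k + ∑ i ∈ Finset.range n, i : ℕ)) : ℤ) =
        (n : ℤ) ^ 2 - 2 * k + 2 * (∑ i ∈ A, i : ℕ) - n * (2 * n - 1) := by
        push_cast at hT ⊢
        linarith
      rw [this]; push_cast; ring
    rw [e] at this
    rw [this]
    have : ((∑ i ∈ A, i : ℕ) - (k + ∑ i ∈ Finset.range n, i : ℕ) : ℤ) = 0 ↔
        ∑ i ∈ A, i = k + ∑ i ∈ Finset.range n, i := by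
      rw [sub_eq_zero]; norm_cast
    simp only [this]
    split_ifs <;> simp
  · intro A _
    apply Continuous.intervalIntegrable
    fun_prop

lemma delta_int (n k : ℕ) :
    Real.pi / 2 * ((SB (2 * n) n (k + 1 + ∑ i ∈ Finset.range n, i)).card -
      (SB (2 * n) n (k + ∑ i ∈ Finset.range n, i)).card : ℝ) =
    ∫ θ in (0 : ℝ)..(Real.pi / 2), XX n θ * (2 * Real.sin (((n : ℝ) ^ 2 - 2 * (k + 1) + 1) * θ) * Real.sin θ) := by
  rw [mul_sub, ← int_XX, ← int_XX, ← intervalIntegral.integral_sub]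
  · congr 1; ext θ
    have e1 : ((n : ℝ) ^ 2 - 2 * ((k + 1 : ℕ) : ℝ)) * θ = ((n : ℝ) ^ 2 - 2 * (k + 1) + 1) * θ - θ := by
      push_cast; ring
    have e2 : ((n : ℝ) ^ 2 - 2 * (k : ℝ)) * θ = ((n : ℝ) ^ 2 - 2 * (k + 1) + 1) * θ + θ := by
      ring
    rw [e1, e2, Real.cos_sub, Real.cos_add]; ring
  all_goals
    apply Continuous.intervalIntegrable
    have := XX_cont n
    fun_prop

/-! ### Analytic bounds -/

lemma FF_pair (n : ℕ) (φ θ : ℝ) : FF n φ θ =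
    ∏ j ∈ Finset.range n, (2 * Real.cos φ + 2 * Real.cos ((2 * j + 1) * θ)) := by
  rw [FF, two_mul, Finset.prod_range_add, ← Finset.prod_range_reflect, ← Finset.prod_mul_distrib]
  refine Finset.prod_congr rfl fun j hj => ?_
  have hj := Finset.mem_range.mp hj
  have e1 : yy n φ θ (n - 1 - j) = φ / 2 - (2 * j + 1) * θ / 2 := by
    have : ((n - 1 - j : ℕ) : ℝ) = n - 1 - j := by
      rw [Nat.cast_sub (by omega), Nat.cast_sub (by omega)]; simp
    rw [yy, this]; ring
  have e2 : yy n φ θ (n + j) = φ / 2 + (2 * j + 1) * θ / 2 := by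
    rw [yy]; push_cast; ring
  have e3 : Real.cos φ = 2 * Real.cos (φ / 2) ^ 2 - 1 := by
    rw [← Real.cos_two_mul]; congr 1; ring
  have e4 : Real.cos ((2 * j + 1) * θ) = 2 * Real.cos ((2 * j + 1) * θ / 2) ^ 2 - 1 := by
    rw [← Real.cos_two_mul]; congr 1; ring
  rw [e1, e2, e3, e4, Real.cos_sub, Real.cos_add]
  have h1 := Real.sin_sq_add_cos_sq (φ / 2)
  have h2 := Real.sin_sq_add_cos_sq ((2 * j + 1) * θ / 2)
  have h1' : Real.sin (φ / 2) ^ 2 = 1 - Real.cos (φ / 2) ^ 2 := by linarith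
  have h2' : Real.sin ((2 * j + 1) * θ / 2) ^ 2 = 1 - Real.cos ((2 * j + 1) * θ / 2) ^ 2 := by linarith
  ring_nf at h1' h2' ⊢
  rw [h1', h2']; ring

lemma FF_cont (n : ℕ) (θ : ℝ) : Continuous fun φ => FF n φ θ := by
  simp only [FF_pair]; fun_prop

lemma tele (n : ℕ) (φ θ : ℝ) : Real.sin θ * ∑ i ∈ Finset.range (2 * n), Real.cos (2 * yy n φ θ i) =
    Real.cos φ * Real.sin (2 * n * θ) := by
  have h : ∀ K : ℕ, Real.sin θ * ∑ i ∈ Finset.range K, Real.cos (2 * yy n φ θ i) =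
      (Real.sin (φ + (2 * K - 2 * n) * θ) - Real.sin (φ - 2 * n * θ)) / 2 := by
    intro K
    induction K with
    | zero => simp; ring_nf
    | succ K ih =>
      rw [Finset.sum_range_succ, mul_add, ih]
      have e1 : φ + (2 * K - 2 * n) * θ = 2 * yy n φ θ K - θ := by rw [yy]; ring
      have e2 : φ + (2 * (K + 1 : ℕ) - 2 * n) * θ = 2 * yy n φ θ K + θ := by rw [yy]; push_cast; ring
      rw [e1, e2, Real.sin_add, Real.sin_sub]; ring
  rw [h]
  have : φ + (2 * (2 * n : ℕ) - 2 * n) * θ = φ + 2 * n * θ := by push_cast; ring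
  rw [this, Real.sin_add, Real.sin_sub]; ring

lemma FF_tail (n : ℕ) (hn : 100 ≤ n) (φ θ : ℝ) (h1 : Real.pi / (3 * n) ≤ θ) (h2 : θ ≤ Real.pi / 2) :
    |FF n φ θ| ≤ 3 ^ n := by
  have hn' : (100 : ℝ) ≤ n := by exact_mod_cast hn
  have hpi := Real.pi_gt_d2
  have hpi2 := Real.pi_lt_d2
  have hx0 : 0 < Real.pi / (3 * n) := by positivity
  have hx1 : Real.pi / (3 * n) ≤ 1 / 50 := by
    rw [div_le_div_iff₀ (by positivity) (by norm_num)]; linarith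
  have hs : 1 / (n : ℝ) ≤ Real.sin θ := by
    have a := Real.sin_gt_sub_cube hx0
    have b : Real.sin (Real.pi / (3 * n)) ≤ Real.sin θ := by
      apply Real.sin_le_sin_of_le_of_le_pi_div_two <;> linarith
    have c : (Real.pi / (3 * n)) = Real.pi / 3 * (1 / n) := by field_simp
    have d : (Real.pi / (3 * n)) ^ 3 ≤ Real.pi / (3 * n) * (1 / 50) ^ 2 := by
      have : (Real.pi / (3 * n)) ^ 2 ≤ (1 / 50) ^ 2 := by gcongr
      nlinarith
    have e : 0 < 1 / (n : ℝ) := by positivity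
    rw [c] at a b d
    nlinarith
  have hs0 : 0 < Real.sin θ := lt_of_lt_of_le (by positivity) hs
  have hsum : ∑ i ∈ Finset.range (2 * n), Real.cos (2 * yy n φ θ i) ≤ n := by
    have ht := tele n φ θ
    have : Real.cos φ * Real.sin (2 * n * θ) ≤ 1 := by
      have : |Real.cos φ * Real.sin (2 * n * θ)| ≤ 1 := by
        rw [abs_mul]
        exact mul_le_one₀ (Real.abs_cos_le_one _) (abs_nonneg _) (Real.abs_sin_le_one _)
      exact (abs_le.mp this).2
    have h3 : 1 ≤ Real.sin θ * n := by
      rw [div_le_iff₀ (by positivity)] at hs; exact hs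
    by_contra hc
    push Not at hc
    have := mul_lt_mul_of_pos_left hc hs0
    linarith
  have hsq : FF n φ θ ^ 2 ≤ (3 ^ n) ^ 2 := by
    have e1 : FF n φ θ ^ 2 = ∏ i ∈ Finset.range (2 * n), (2 + 2 * Real.cos (2 * yy n φ θ i)) := by
      rw [FF, ← Finset.prod_pow]
      refine Finset.prod_congr rfl fun i _ => ?_
      rw [Real.cos_two_mul]; ring
    have e2 : ∏ i ∈ Finset.range (2 * n), (2 + 2 * Real.cos (2 * yy n φ θ i)) ≤
        ∏ i ∈ Finset.range (2 * n), (3 * Real.exp ((2 + 2 * Real.cos (2 * yy n φ θ i)) / 3 - 1)) := by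
      refine Finset.prod_le_prod (fun i _ => ?_) (fun i _ => ?_)
      · have := Real.neg_one_le_cos (2 * yy n φ θ i); linarith
      · have := Real.add_one_le_exp ((2 + 2 * Real.cos (2 * yy n φ θ i)) / 3 - 1); linarith
    have e3 : ∏ i ∈ Finset.range (2 * n), (3 * Real.exp ((2 + 2 * Real.cos (2 * yy n φ θ i)) / 3 - 1)) ≤
        3 ^ (2 * n) * 1 := by
      rw [Finset.prod_mul_distrib, ← Real.exp_sum]
      simp only [Finset.prod_const, Finset.card_range]
      gcongr
      rw [Real.exp_le_one_iff, Finset.sum_sub_distrib, ← Finset.sum_div, Finset.sum_add_distrib,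
        ← Finset.mul_sum]
      simp
      linarith
    rw [e1, ← pow_mul, mul_comm n 2]
    linarith
  exact abs_le_of_sq_le_sq hsq (by positivity)

lemma FF_ge (n : ℕ) (hn : 100 ≤ n) (φ θ : ℝ) (h1 : 0 ≤ θ) (h2 : θ ≤ Real.pi / 2) (hφ : |φ| ≤ Real.pi) :
    -3 ^ n ≤ FF n φ θ := by
  have hn' : (100 : ℝ) ≤ n := by exact_mod_cast hn
  rcases le_total (Real.pi / (3 * n)) θ with h | h
  · exact (abs_le.mp (FF_tail n hn φ θ h h2)).1
  have hpi := Real.pi_pos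
  have hc : ∀ j ∈ Finset.range n, -(1 / 2) ≤ Real.cos ((2 * j + 1) * θ) := by
    intro j hj
    have hj : (j : ℝ) + 1 ≤ n := by exact_mod_cast Finset.mem_range.mp hj
    have : Real.cos (Real.pi - Real.pi / 3) = - (1 / 2) := by rw [Real.cos_pi_sub, Real.cos_pi_div_three]
    rw [← this]
    apply Real.cos_le_cos_of_nonneg_of_le_pi
    · positivity
    · linarith
    · rw [le_div_iff₀ (by positivity)] at h
      nlinarith
  rw [FF_pair]
  rcases le_total |φ| (Real.pi / 3) with hp | hp
  · have : 0 ≤ ∏ j ∈ Finset.range n, (2 * Real.cos φ + 2 * Real.cos ((2 * j + 1) * θ)) := by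
      refine Finset.prod_nonneg fun j hj => ?_
      have := hc j hj
      have : 1 / 2 ≤ Real.cos φ := by
        rw [← Real.cos_pi_div_three, ← Real.cos_abs φ]
        apply Real.cos_le_cos_of_nonneg_of_le_pi (abs_nonneg _) (by linarith) hp
      linarith
    have : (0 : ℝ) < 3 ^ n := by positivity
    linarith
  · have : |∏ j ∈ Finset.range n, (2 * Real.cos φ + 2 * Real.cos ((2 * j + 1) * θ))| ≤ 3 ^ n := by
      rw [Finset.abs_prod]
      calc _ ≤ ∏ j ∈ Finset.range n, (3 : ℝ) := by
            refine Finset.prod_le_prod (fun j _ => abs_nonneg _) fun j hj => ?_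
            have h3 := hc j hj
            have h4 : Real.cos φ ≤ 1 / 2 := by
              rw [← Real.cos_pi_div_three, ← Real.cos_abs φ]
              apply Real.cos_le_cos_of_nonneg_of_le_pi (by positivity) hφ hp
            have h5 := Real.neg_one_le_cos φ
            have h6 := Real.cos_le_one ((2 * j + 1) * θ)
            rw [abs_le]; constructor <;> linarith
        _ = 3 ^ n := by simp
    exact (abs_le.mp this).1

lemma prod_one_sub (s : Finset ℕ) (x : ℕ → ℝ) (h0 : ∀ i, 0 ≤ x i) (h1 : ∀ i ∈ s, x i ≤ 1) :
    1 - ∑ i ∈ s, x i ≤ ∏ i ∈ s, (1 - x i) := by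
  induction s using Finset.induction_on with
  | empty => simp
  | insert a s ha ih =>
    rw [Finset.sum_insert ha, Finset.prod_insert ha]
    have h2 := ih fun i hi => h1 i (Finset.mem_insert_of_mem hi)
    have h3 := h1 a (Finset.mem_insert_self _ _)
    have h4 := Finset.sum_nonneg fun i (_ : i ∈ s) => h0 i
    have h5 := mul_le_mul_of_nonneg_left h2 (by linarith : 0 ≤ 1 - x a)
    have h6 := mul_nonneg (h0 a) h4
    nlinarith

lemma FF_near (n : ℕ) (hn : 100 ≤ n) (e φ θ : ℝ) (he : 0 < e) (hen : e ^ 2 * n = 1)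
    (hθ0 : 0 ≤ θ) (hθ : θ ≤ e ^ 3) (hφ : |φ| ≤ e) : 5 / 12 * 4 ^ n ≤ FF n φ θ := by
  have hn' : (100 : ℝ) ≤ n := by exact_mod_cast hn
  set x : ℕ → ℝ := fun j => (e ^ 2 + (2 * j + 1) ^ 2 * e ^ 6) / 4 with hx
  have hx0 : ∀ j, 0 ≤ x j := fun j => by simp only [hx]; positivity
  have hsumx : ∑ j ∈ Finset.range n, x j ≤ 7 / 12 := by
    have h : ∀ K : ℕ, ∑ j ∈ Finset.range K, x j = (K * e ^ 2 + K * (4 * K ^ 2 - 1) / 3 * e ^ 6) / 4 := by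
      intro K
      induction K with
      | zero => simp
      | succ K ih => rw [Finset.sum_range_succ, ih, hx]; push_cast; ring
    rw [h]
    have : (n : ℝ) * e ^ 2 + n * (4 * n ^ 2 - 1) / 3 * e ^ 6 =
      (e ^ 2 * n) + 4 / 3 * (e ^ 2 * n) ^ 3 - n * e ^ 6 / 3 := by ring
    rw [this, hen]
    have : 0 ≤ n * e ^ 6 := by positivity
    linarith
  have hx1 : ∀ j ∈ Finset.range n, x j ≤ 1 := by
    intro j hj
    have := Finset.single_le_sum (fun i _ => hx0 i) hj
    linarith
  have hp := prod_one_sub _ x hx0 hx1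
  have hφ2 : φ ^ 2 ≤ e ^ 2 := sq_le_sq' (abs_le.mp hφ).1 (abs_le.mp hφ).2
  have hθ2 : θ ^ 2 ≤ e ^ 6 := by
    calc θ ^ 2 ≤ (e ^ 3) ^ 2 := by gcongr
      _ = e ^ 6 := by ring
  have hle : ∏ j ∈ Finset.range n, (4 * (1 - x j)) ≤ FF n φ θ := by
    rw [FF_pair]
    refine Finset.prod_le_prod (fun j hj => ?_) (fun j _ => ?_)
    · have := hx1 j hj; linarith
    · have a := Real.one_sub_sq_div_two_le_cos (x := φ)
      have b := Real.one_sub_sq_div_two_le_cos (x := (2 * j + 1) * θ)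
      have c : ((2 * j + 1) * θ) ^ 2 ≤ (2 * j + 1) ^ 2 * e ^ 6 := by
        rw [mul_pow]; gcongr
      simp only [hx]
      linarith
  rw [Finset.prod_mul_distrib] at hle
  simp only [Finset.prod_const, Finset.card_range] at hle
  have h4 : (0 : ℝ) < 4 ^ n := by positivity
  nlinarith

lemma XX_tail (n : ℕ) (hn : 100 ≤ n) (θ : ℝ) (h1 : Real.pi / (3 * n) ≤ θ) (h2 : θ ≤ Real.pi / 2) :
    |XX n θ| ≤ 3 ^ n := by
  have hpi := Real.pi_pos
  have := intervalIntegral.norm_integral_le_of_norm_le_const (a := -Real.pi) (b := Real.pi)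
    (f := fun φ => FF n φ θ) (C := 3 ^ n) (fun φ _ => FF_tail n hn φ θ h1 h2)
  rw [XX, abs_div, abs_of_pos (by positivity : 0 < 2 * Real.pi), div_le_iff₀ (by positivity)]
  rw [Real.norm_eq_abs, abs_of_pos (by linarith : 0 < Real.pi - -Real.pi)] at this
  linarith

lemma XX_ge (n : ℕ) (hn : 100 ≤ n) (θ : ℝ) (h1 : 0 ≤ θ) (h2 : θ ≤ Real.pi / 2) :
    -3 ^ n ≤ XX n θ := by
  have hpi := Real.pi_pos
  have := intervalIntegral.integral_mono_on (a := -Real.pi) (b := Real.pi)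
    (f := fun _ => -(3 : ℝ) ^ n) (g := fun φ => FF n φ θ) (μ := MeasureTheory.volume) (by linarith)
    (by simp) ((FF_cont n θ).intervalIntegrable _ _)
    (fun φ hφ => FF_ge n hn φ θ h1 h2 (abs_le.mpr ⟨hφ.1, hφ.2⟩))
  rw [intervalIntegral.integral_const, smul_eq_mul] at this
  rw [XX, le_div_iff₀ (by positivity)]
  linarith

lemma XX_near (n : ℕ) (hn : 100 ≤ n) (e θ : ℝ) (he : 0 < e) (hen : e ^ 2 * n = 1)
    (h1 : 0 ≤ θ) (h2 : θ ≤ e ^ 3) : 5 / 12 * 4 ^ n * e / Real.pi ≤ XX n θ + 3 ^ n := by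
  have hpi := Real.pi_gt_three
  have hn' : (100 : ℝ) ≤ n := by exact_mod_cast hn
  have he1 : e ≤ 1 := by
    by_contra hc
    push Not at hc
    have : 1 ≤ e ^ 2 := by nlinarith
    nlinarith
  have he3 : e ^ 3 ≤ 1 := pow_le_one₀ he.le he1
  have hc : Continuous fun φ => FF n φ θ + 3 ^ n := (FF_cont n θ).add continuous_const
  have a := intervalIntegral.integral_mono_interval (a := -e) (b := e) (c := -Real.pi) (d := Real.pi)
    (f := fun φ => FF n φ θ + 3 ^ n) (μ := MeasureTheory.volume) (by linarith) (by linarith) (by linarith)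
    (by
      refine (MeasureTheory.ae_restrict_iff' measurableSet_Ioc).mpr (Filter.Eventually.of_forall ?_)
      intro φ hφ
      have := FF_ge n hn φ θ h1 (by linarith) (abs_le.mpr ⟨hφ.1.le, hφ.2⟩)
      simp only [Pi.zero_apply]
      linarith)
    (hc.intervalIntegrable _ _)
  have b := intervalIntegral.integral_mono_on (a := -e) (b := e)
    (f := fun _ => 5 / 12 * (4 : ℝ) ^ n) (g := fun φ => FF n φ θ + 3 ^ n) (μ := MeasureTheory.volume) (by linarith)
    (by simp) (hc.intervalIntegrable _ _)
    (fun φ hφ => by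
      have := FF_near n hn e φ θ he hen h1 h2 (abs_le.mpr ⟨hφ.1, hφ.2⟩)
      have h3 : (0 : ℝ) < 3 ^ n := by positivity
      linarith)
  rw [intervalIntegral.integral_const, smul_eq_mul] at b
  rw [intervalIntegral.integral_add ((FF_cont n θ).intervalIntegrable _ _) (by simp) (a := -Real.pi)] at a
  rw [intervalIntegral.integral_const, smul_eq_mul] at a
  have hX : ∫ φ in (-Real.pi)..Real.pi, FF n φ θ = XX n θ * (2 * Real.pi) := by
    rw [XX]; field_simp
  rw [hX] at a
  rw [div_le_iff₀ (by positivity)]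
  linarith

set_option maxHeartbeats 1000000 in
lemma delta_big (n k : ℕ) (hn : 100 ≤ n) (h1 : (n - 1) ^ 2 < 2 * (k + 1)) (h2 : 2 * (k + 1) ≤ n ^ 2) :
    (20 / 882 : ℝ) * (4 ^ n / n ^ 5) - 2 * 3 ^ n ≤ ((SB (2 * n) n (k + 1 + ∑ i ∈ Finset.range n, i)).card -
      (SB (2 * n) n (k + ∑ i ∈ Finset.range n, i)).card : ℝ) := by
  have hn' : (100 : ℝ) ≤ n := by exact_mod_cast hn
  have hpi := Real.pi_gt_three
  have hpi2 := Real.pi_lt_d2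
  set D : ℝ := ((SB (2 * n) n (k + 1 + ∑ i ∈ Finset.range n, i)).card -
      (SB (2 * n) n (k + ∑ i ∈ Finset.range n, i)).card : ℝ) with hD
  have hint := delta_int n k
  rw [← hD] at hint
  set m : ℝ := (n : ℝ) ^ 2 - 2 * (k + 1) + 1 with hm
  have hm1 : 1 ≤ m := by
    have : (2 * (k + 1) : ℝ) ≤ n ^ 2 := by exact_mod_cast h2
    linarith
  have hm2 : m ≤ 2 * n := by
    have : ((n - 1 : ℕ) : ℝ) ^ 2 < 2 * (k + 1) := by exact_mod_cast h1
    rw [Nat.cast_sub (by omega)] at this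
    push_cast at this
    nlinarith
  obtain ⟨e, he, hen⟩ : ∃ e : ℝ, 0 < e ∧ e ^ 2 * n = 1 := by
    refine ⟨1 / Real.sqrt n, by positivity, ?_⟩
    rw [div_pow, Real.sq_sqrt (by positivity)]; field_simp
  have he1 : e ≤ 1 / 10 := by
    by_contra hc
    push Not at hc
    have : 1 / 100 < e ^ 2 := by nlinarith
    nlinarith
  have h3pos : (0 : ℝ) < 3 ^ n := by positivity
  have h4pos : (0 : ℝ) < 4 ^ n := by positivity
  set h : ℝ → ℝ := fun θ => XX n θ * (2 * Real.sin (m * θ) * Real.sin θ) + 2 * 3 ^ n with hh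
  have hXc := XX_cont n
  have hcont0 : Continuous fun θ => XX n θ * (2 * Real.sin (m * θ) * Real.sin θ) := by fun_prop
  have hcont : Continuous h := hcont0.add continuous_const
  have he2 : e ^ 2 = 1 / n := by field_simp; linarith
  have he3 : e ^ 3 ≤ Real.pi / (3 * n) := by
    have : e ^ 3 = e * (1 / n) := by rw [← he2]; ring
    rw [this]
    have : Real.pi / (3 * n) = Real.pi / 3 * (1 / n) := by field_simp
    rw [this]
    gcongr
    linarith
  have hpn : Real.pi / (3 * n) ≤ Real.pi / 2 := by gcongr; linarith
  have hsmall : ∀ θ, 0 ≤ θ → θ ≤ Real.pi / (3 * n) →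
      0 ≤ Real.sin (m * θ) * Real.sin θ ∧ Real.sin (m * θ) * Real.sin θ ≤ 1 := by
    intro θ a b
    have c : 0 ≤ Real.sin (m * θ) := by
      apply Real.sin_nonneg_of_nonneg_of_le_pi (by positivity)
      rw [le_div_iff₀ (by positivity)] at b
      nlinarith
    have d : 0 ≤ Real.sin θ := Real.sin_nonneg_of_nonneg_of_le_pi a (by linarith)
    exact ⟨mul_nonneg c d, mul_le_one₀ (Real.sin_le_one _) d (Real.sin_le_one _)⟩
  have hnonneg : ∀ θ, 0 ≤ θ → θ ≤ Real.pi / 2 → 0 ≤ h θ := by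
    intro θ a b
    simp only [hh]
    rcases le_total (Real.pi / (3 * n)) θ with hc | hc
    · have t := XX_tail n hn θ hc b
      have : |XX n θ * (Real.sin (m * θ) * Real.sin θ)| ≤ 3 ^ n * 1 := by
        rw [abs_mul]
        gcongr
        rw [abs_mul]
        exact mul_le_one₀ (Real.abs_sin_le_one _) (abs_nonneg _) (Real.abs_sin_le_one _)
      have := (abs_le.mp this).1
      linarith
    · obtain ⟨g0, g1⟩ := hsmall θ a hc
      have := XX_ge n hn θ a b
      nlinarith
  have hlow : ∀ θ, 0 ≤ θ → θ ≤ e ^ 3 →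
      5 / 12 * 4 ^ n * e / Real.pi * (8 / Real.pi ^ 2) * θ ^ 2 ≤ h θ := by
    intro θ a b
    obtain ⟨g0, g1⟩ := hsmall θ a (b.trans he3)
    have t := XX_near n hn e θ he hen a b
    have hmt : m * θ ≤ Real.pi / 2 := by
      have : e ^ 3 * n = e := by
        have : e ^ 3 * n = e * (e ^ 2 * n) := by ring
        rw [this, hen, mul_one]
      nlinarith
    have s1 := Real.mul_le_sin (by positivity : 0 ≤ m * θ) hmt
    have s2 := Real.mul_le_sin a (by linarith : θ ≤ Real.pi / 2)
    have s3 : 2 / Real.pi * θ ≤ Real.sin (m * θ) := by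
      refine le_trans ?_ s1
      gcongr
      nlinarith
    have g2 : (2 / Real.pi * θ) * (2 / Real.pi * θ) ≤ Real.sin (m * θ) * Real.sin θ := by
      apply mul_le_mul s3 s2 (by positivity)
      exact le_trans (by positivity) s3
    have hA : 0 ≤ 5 / 12 * 4 ^ n * e / Real.pi := by positivity
    calc 5 / 12 * 4 ^ n * e / Real.pi * (8 / Real.pi ^ 2) * θ ^ 2
        = 5 / 12 * 4 ^ n * e / Real.pi * (2 * ((2 / Real.pi * θ) * (2 / Real.pi * θ))) := by
          ring
      _ ≤ (XX n θ + 3 ^ n) * (2 * (Real.sin (m * θ) * Real.sin θ)) := by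
          apply mul_le_mul t (by linarith) (by positivity) (by linarith)
      _ ≤ h θ := by
          simp only [hh]
          nlinarith
  have a := intervalIntegral.integral_mono_interval (a := 0) (b := e ^ 3) (c := 0) (d := Real.pi / 2)
    (f := h) (μ := MeasureTheory.volume) le_rfl (by positivity) (by linarith)
    (by
      refine (MeasureTheory.ae_restrict_iff' measurableSet_Ioc).mpr (Filter.Eventually.of_forall ?_)
      intro θ hθ
      exact hnonneg θ hθ.1.le hθ.2)
    (hcont.intervalIntegrable _ _)
  have b := intervalIntegral.integral_mono_on (a := 0) (b := e ^ 3)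
    (f := fun θ => 5 / 12 * 4 ^ n * e / Real.pi * (8 / Real.pi ^ 2) * θ ^ 2) (g := h)
    (μ := MeasureTheory.volume) (by positivity)
    (Continuous.intervalIntegrable (by fun_prop) _ _) (hcont.intervalIntegrable _ _)
    (fun θ hθ => hlow θ hθ.1 hθ.2)
  rw [intervalIntegral.integral_const_mul, integral_pow] at b
  simp only [hh] at a
  rw [intervalIntegral.integral_add (hcont0.intervalIntegrable _ _) (by simp) (a := 0) (b := Real.pi / 2),
    ← hint, intervalIntegral.integral_const, smul_eq_mul] at a
  have c := b.trans a
  have e10 : e ^ 10 = 1 / n ^ 5 := by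
    have : e ^ 10 = (e ^ 2) ^ 5 := by ring
    rw [this, he2, div_pow, one_pow]
  have f1 : 5 / 12 * 4 ^ n * e / Real.pi * (8 / Real.pi ^ 2) * (((e ^ 3) ^ (2 + 1) - 0 ^ (2 + 1)) / ((2 : ℕ) + 1)) =
      10 / 9 * (4 ^ n / n ^ 5) / Real.pi ^ 3 := by
    have : 5 / 12 * 4 ^ n * e / Real.pi * (8 / Real.pi ^ 2) * (((e ^ 3) ^ (2 + 1) - 0 ^ (2 + 1)) / ((2 : ℕ) + 1)) =
       10 / 9 * 4 ^ n * e ^ 10 / Real.pi ^ 3 := by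
      push_cast; field_simp; ring
    rw [this, e10]; ring
  rw [f1, div_le_iff₀ (by positivity)] at c
  have hq : 0 < (4 : ℝ) ^ n / n ^ 5 := by positivity
  have hpi4 : Real.pi ^ 4 ≤ 98 := by
    have : Real.pi ^ 4 ≤ 3.146 ^ 4 := by gcongr; linarith [Real.pi_lt_d4]
    norm_num at this ⊢
    linarith
  have c2 : 10 / 9 * ((4 : ℝ) ^ n / n ^ 5) ≤ (D + 2 * 3 ^ n) / 2 * Real.pi ^ 4 := by
    refine c.trans (le_of_eq ?_); ring
  have hpos : 0 ≤ D + 2 * 3 ^ n := by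
    by_contra hc
    push Not at hc
    have : 0 < Real.pi ^ 4 := by positivity
    nlinarith
  nlinarith

lemma big_ineq (n : ℕ) (hn : 100 ≤ n) : (2 : ℝ) ^ n ≤ (20 / 882 : ℝ) * (4 ^ n / n ^ 5) - 2 * 3 ^ n := by
  have h : 140 * 3 ^ n * n ^ 5 ≤ 4 ^ n := by
    induction n, hn using Nat.le_induction with
    | base => norm_num
    | succ n hn ih =>
      have : 3 * (n + 1) ^ 5 ≤ 4 * n ^ 5 := by
        obtain ⟨t, rfl⟩ := Nat.exists_eq_add_of_le hn
        ring_nf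
        nlinarith [sq_nonneg t, pow_nonneg (Nat.zero_le t) 3, pow_nonneg (Nat.zero_le t) 4, pow_nonneg (Nat.zero_le t) 5]
      calc 140 * 3 ^ (n + 1) * (n + 1) ^ 5 = 140 * 3 ^ n * (3 * (n + 1) ^ 5) := by ring
        _ ≤ 140 * 3 ^ n * (4 * n ^ 5) := by gcongr
        _ = 4 * (140 * 3 ^ n * n ^ 5) := by ring
        _ ≤ 4 * 4 ^ n := by gcongr
        _ = 4 ^ (n + 1) := by ring
  have hn' : (0 : ℝ) < n := by exact_mod_cast (by omega : 0 < n)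
  have h' : (140 * 3 ^ n * n ^ 5 : ℝ) ≤ 4 ^ n := by exact_mod_cast h
  rw [← le_div_iff₀ (by positivity)] at h'
  have h2 : (2 : ℝ) ^ n ≤ 3 ^ n := by gcongr; norm_num
  have : (0 : ℝ) < 3 ^ n := by positivity
  linarith

/-! ### Finite check -/

/-- evaluate the argument first -/
def forceN (x : ℕ) (f : ℕ → Bool) : Bool :=
  match x with
  | 0 => f 0
  | m + 1 => f (m + 1)

lemma forceN_eq (x : ℕ) (f : ℕ → Bool) : forceN x f = f x := by
  cases x <;> rfl

/-- check consecutive base-`Q` digits -/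
def pk (Q B A : ℕ) : ℕ → ℕ → Bool
  | 0, _ => true
  | c + 1, W => forceN (W / Q) fun W' => Nat.ble (A + (W % Q) * B) ((W' % Q) * B) && pk Q B A c W'

lemma pk_spec (Q B A : ℕ) : ∀ c W, pk Q B A c W = true →
    ∀ i < c, A + (W / Q ^ i % Q) * B ≤ (W / Q ^ (i + 1) % Q) * B := by
  intro c
  induction c with
  | zero => intro W _ i hi; omega
  | succ c ih =>
    intro W h i hi
    rw [pk, forceN_eq, Bool.and_eq_true] at h
    rcases i with _ | i
    · simpa using Nat.le_of_ble_eq_true h.1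
    · have := ih _ h.2 i (by omega)
      rw [Nat.div_div_eq_div_mul, Nat.div_div_eq_div_mul, ← pow_succ', ← pow_succ'] at this
      exact this

/-- the check for one square -/
def rowc (Q n E : ℕ) : Bool :=
  Nat.ble n 8 || forceN (E / Q ^ ((n - 1) ^ 2 / 2)) fun W =>
    pk Q ((n - 1) ^ 4) (2 ^ n) (n ^ 2 / 2 - (n - 1) ^ 2 / 2) W

/-- the loop over all squares -/
def outer (Q : ℕ) : ℕ → ℕ → ℕ → Bool
  | 0, _, _ => true
  | f + 1, n, E => forceN (n + 1) fun n1 =>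
      forceN (E * ((Q ^ (2 * n + 1) - 1) * (Q ^ (2 * n + 2) - 1)) / ((Q ^ (n + 1) - 1) * (Q ^ (n + 1) - 1)))
        fun E1 => rowc Q n1 E1 && outer Q f n1 E1

lemma outer_spec (Q : ℕ) : ∀ f n, outer Q f n (EV Q n) = true →
    ∀ j, n < j → j ≤ n + f → rowc Q j (EV Q j) = true := by
  intro f
  induction f with
  | zero => intro n _ j h1 h2; omega
  | succ f ih =>
    intro n h j h1 h2
    rw [outer, forceN_eq, forceN_eq, Bool.and_eq_true] at h
    rcases Nat.lt_or_ge (n + 1) j with h3 | h3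
    · exact ih (n + 1) h.2 j h3 (by omega)
    · have : j = n + 1 := by omega
      subst this
      exact h.1

lemma outer_check : outer (2 ^ 200) 99 0 1 = true := by decide +kernel

lemma row8_check : pk (2 ^ 200) 1 1 31 (EV (2 ^ 200) 8 / (2 ^ 200) ^ 1) = true := by decide +kernel

lemma digit (n k : ℕ) (hn : n < 100) :
    EV (2 ^ 200) n / (2 ^ 200) ^ k % 2 ^ 200 = (GP n n).coeff k := by
  rw [EV_eq _ (by norm_num)]
  apply coeff_eval
  intro i
  calc (GP n n).coeff i ≤ 2 ^ (n + n) := GP_coeff_le n n i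
    _ < 2 ^ 200 := Nat.pow_lt_pow_right (by norm_num) (by omega)

lemma small8 (k : ℕ) (h1 : 1 ≤ k) (h2 : k < 32) : 1 + (GP 8 8).coeff k ≤ (GP 8 8).coeff (k + 1) := by
  have h := pk_spec _ _ _ _ _ row8_check (k - 1) (by omega)
  rw [Nat.div_div_eq_div_mul, Nat.div_div_eq_div_mul, ← pow_add, ← pow_add, digit _ _ (by norm_num),
    digit _ _ (by norm_num), mul_one, mul_one] at h
  rwa [show 1 + (k - 1) = k by omega, show 1 + (k - 1 + 1) = k + 1 by omega] at h

lemma small_check (n k : ℕ) (hn : 9 ≤ n) (hn2 : n < 100) (h1 : (n - 1) ^ 2 < 2 * (k + 1))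
    (h2 : 2 * (k + 1) ≤ n ^ 2) :
    2 ^ n + (GP n n).coeff k * (n - 1) ^ 4 ≤ (GP n n).coeff (k + 1) * (n - 1) ^ 4 := by
  have h := outer_spec (2 ^ 200) 99 0 outer_check n (by omega) (by omega)
  rw [rowc, Bool.or_eq_true, forceN_eq] at h
  rcases h with h | h
  · have := Nat.le_of_ble_eq_true h; omega
  · have h := pk_spec _ _ _ _ _ h (k - (n - 1) ^ 2 / 2) (by omega)
    rw [Nat.div_div_eq_div_mul, Nat.div_div_eq_div_mul, ← pow_add, ← pow_add, digit _ _ hn2,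
      digit _ _ hn2] at h
    have e : (n - 1) ^ 2 / 2 + (k - (n - 1) ^ 2 / 2) = k := by omega
    rwa [← add_assoc, e] at h

/-! ### Conclusion -/

lemma C_le_one : Real.sqrt (27 / 8) / Real.pi ^ ((3 : ℝ) / 2) ≤ 1 := by
  have hpi := Real.pi_gt_three
  rw [div_le_one (by positivity)]
  have h1 : Real.sqrt (27 / 8) ≤ 2 := by
    rw [Real.sqrt_le_left (by norm_num)]; norm_num
  have h2 : (3 : ℝ) ≤ Real.pi ^ ((3 : ℝ) / 2) := by
    calc (3 : ℝ) ≤ Real.pi ^ (1 : ℝ) := by rw [Real.rpow_one]; exact hpi.le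
      _ ≤ Real.pi ^ ((3 : ℝ) / 2) := Real.rpow_le_rpow_of_exponent_le (by linarith) (by norm_num)
  linarith

lemma rhs_le (x : ℝ) (a N : ℕ) (hx : 1 ≤ x) (ha : (a : ℝ) ^ 2 ≤ x) (hN : x ≤ (N : ℝ) ^ 2) (ha0 : 0 < a) :
    (Real.sqrt (27 / 8) / Real.pi ^ ((3 : ℝ) / 2)) * 2 ^ Real.sqrt x / x ^ ((9 : ℝ) / 4) ≤
      2 ^ N / (a : ℝ) ^ 4 := by
  have ha0' : (0 : ℝ) < a := by exact_mod_cast ha0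
  have h1 : (2 : ℝ) ^ Real.sqrt x ≤ 2 ^ N := by
    rw [← Real.rpow_natCast]
    apply Real.rpow_le_rpow_of_exponent_le (by norm_num)
    exact Real.sqrt_le_iff.mpr ⟨by positivity, hN⟩
  have h2 : (a : ℝ) ^ 4 ≤ x ^ ((9 : ℝ) / 4) := by
    calc (a : ℝ) ^ 4 = (a ^ 2) ^ 2 := by ring
      _ ≤ x ^ 2 := by gcongr
      _ = x ^ (2 : ℝ) := by norm_num
      _ ≤ _ := Real.rpow_le_rpow_of_exponent_le hx (by norm_num)
  have h3 : (Real.sqrt (27 / 8) / Real.pi ^ ((3 : ℝ) / 2)) * 2 ^ Real.sqrt x ≤ 1 * 2 ^ N := by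
    apply mul_le_mul C_le_one h1 (by positivity) (by norm_num)
  rw [one_mul] at h3
  exact div_le_div₀ (by positivity) h3 (by positivity) h2

lemma coeff_bound (n k : ℕ) (hn : 8 ≤ n) (hk1 : 1 ≤ k) (hk : 2 * (k + 1) ≤ n ^ 2) :
    (Real.sqrt (27 / 8) / Real.pi ^ ((3 : ℝ) / 2)) *
        2 ^ Real.sqrt (2 * ((k + 1 : ℕ) : ℝ)) / (2 * ((k + 1 : ℕ) : ℝ)) ^ ((9 : ℝ) / 4) ≤
      ((GP n n).coeff (k + 1) : ℝ) - (GP n n).coeff k := by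
  have hx1 : (1 : ℝ) ≤ 2 * ((k + 1 : ℕ) : ℝ) := by
    exact_mod_cast (by omega : 1 ≤ 2 * (k + 1))
  rcases Nat.lt_or_ge k 32 with h | h
  · have hs := small8 k hk1 h
    have hm := delta_mono_le 8 n k hn (by omega)
    have h1 : (1 : ℝ) + (GP n n).coeff k ≤ (GP n n).coeff (k + 1) := by
      exact_mod_cast (by omega : 1 + (GP n n).coeff k ≤ (GP n n).coeff (k + 1))
    refine le_trans ?_ (by linarith : (1 : ℝ) ≤ _)
    rcases Nat.lt_or_ge (2 * (k + 1)) 17 with h3 | h3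
    · refine (rhs_le _ 2 4 hx1 ?_ ?_ (by norm_num)).trans (by norm_num)
      · exact_mod_cast (by omega : 2 ^ 2 ≤ 2 * (k + 1))
      · exact_mod_cast (by omega : 2 * (k + 1) ≤ 4 ^ 2)
    · refine (rhs_le _ 4 8 hx1 ?_ ?_ (by norm_num)).trans (by norm_num)
      · exact_mod_cast (by omega : 4 ^ 2 ≤ 2 * (k + 1))
      · exact_mod_cast (by omega : 2 * (k + 1) ≤ 8 ^ 2)
  · obtain ⟨N, hN9, hNn, hN1, hN2⟩ : ∃ N, 9 ≤ N ∧ N ≤ n ∧ (N - 1) ^ 2 < 2 * (k + 1) ∧ 2 * (k + 1) ≤ N ^ 2 := by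
      have hex : ∃ N, 2 * (k + 1) ≤ N ^ 2 := ⟨n, hk⟩
      have h9 : 9 ≤ Nat.find hex := by
        by_contra hc
        have : (Nat.find hex) ^ 2 ≤ 8 ^ 2 := Nat.pow_le_pow_left (by omega) 2
        have := Nat.find_spec hex
        omega
      refine ⟨Nat.find hex, h9, Nat.find_min' hex hk, ?_, Nat.find_spec hex⟩
      have := Nat.find_min hex (m := Nat.find hex - 1) (by omega)
      omega
    have hm := delta_mono_le N n k hNn hN2
    have hm' : ((GP N N).coeff (k + 1) : ℝ) - (GP N N).coeff k ≤ (GP n n).coeff (k + 1) - (GP n n).coeff k := by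
      have : ((GP N N).coeff (k + 1) : ℝ) + (GP n n).coeff k ≤ (GP N N).coeff k + (GP n n).coeff (k + 1) := by
        exact_mod_cast hm
      linarith
    refine le_trans ?_ hm'
    have hr := rhs_le (2 * ((k + 1 : ℕ) : ℝ)) (N - 1) N hx1 (by exact_mod_cast hN1.le) (by exact_mod_cast hN2)
      (by omega)
    refine hr.trans ?_
    have hN0 : (1 : ℝ) ≤ ((N - 1 : ℕ) : ℝ) := by exact_mod_cast (by omega : 1 ≤ N - 1)
    rcases Nat.lt_or_ge N 100 with h100 | h100
    · have hc := small_check N k hN9 h100 hN1 hN2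
      rw [div_le_iff₀ (by positivity)]
      have : (2 : ℝ) ^ N + (GP N N).coeff k * ((N - 1 : ℕ) : ℝ) ^ 4 ≤
          (GP N N).coeff (k + 1) * ((N - 1 : ℕ) : ℝ) ^ 4 := by exact_mod_cast hc
      linarith
    · have hb := (big_ineq N h100).trans (delta_big N k h100 hN1 hN2)
      rw [two_mul N, SB_card, SB_card] at hb
      refine le_trans ?_ hb
      exact div_le_self (by positivity) (one_le_pow₀ hN0)

theorem stmt_12 (n k : ℕ) (hn : 8 ≤ n) (hk2 : 2 ≤ k) (hk : 2 * k ≤ n ^ 2) :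
    (p k n n : ℝ) - p (k - 1) n n ≥
      (Real.sqrt (27 / 8) / Real.pi ^ ((3 : ℝ) / 2)) *
        2 ^ Real.sqrt (2 * (k : ℝ)) / (2 * (k : ℝ)) ^ ((9 : ℝ) / 4) := by
  obtain ⟨j, rfl⟩ : ∃ j, k = j + 1 := ⟨k - 1, by omega⟩
  rw [p_eq_coeff _ n n _ rfl, p_eq_coeff _ n n _ rfl, Nat.add_sub_cancel]
  exact coeff_bound n j hn (by omega) hk
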